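/- Let G be a connected bipartite graph of order n = 2a ≥ 5 with both parts of size a. Then DLE(G) ≥ 12a(a−1) − 4(n−2)W(G)/n, with equality if and only if G ≅ K_{a,a}. -/

import Mathlib

open Finset Matrix BigOperators

variable {V : Type*} [Fintype V] [DecidableEq V]

/-- The transmission of a vertex: the sum of distances to all other vertices. -/
noncomputable def transmission (G : SimpleGraph V) (v : V) : ℕ := ∑ u, G.dist v u

/-- The distance matrix of a graph. -/
noncomputable def distMatrix (G : SimpleGraph V) : Matrix V V ℝ :=
  fun u v => (G.dist u v : ℝ)

/-- The distance Laplacian matrix `Tr(G) - D(G)`. -/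
noncomputable def distLap (G : SimpleGraph V) : Matrix V V ℝ :=
  Matrix.diagonal (fun v => (transmission G v : ℝ)) - distMatrix G

/-- The Wiener index of a graph. -/
noncomputable def wiener (G : SimpleGraph V) : ℝ := (∑ v, (transmission G v : ℝ)) / 2

/-- `ρ` lists the eigenvalues of the (Hermitian) matrix `M` in nonincreasing order. -/
def IsSpectrum {n : ℕ} (M : Matrix (Fin n) (Fin n) ℝ) (ρ : Fin n → ℝ) : Prop :=
  Antitone ρ ∧ ∃ (hM : M.IsHermitian) (e : Fin n ≃ Fin n), ∀ i, ρ i = hM.eigenvalues (e i)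

/-- Distance Laplacian energy, given the eigenvalue list `ρ`. -/
noncomputable def DLEnergy {n : ℕ} (G : SimpleGraph (Fin n)) (ρ : Fin n → ℝ) : ℝ :=
  ∑ i, |ρ i - 2 * wiener G / n|

/-- The graph has diameter two. -/
def diamTwo (G : SimpleGraph V) : Prop :=
  (∀ u v, G.dist u v ≤ 2) ∧ ∃ u v, G.dist u v = 2

/-- The multiset of eigenvalues of a Hermitian matrix. -/
noncomputable def eigMultiset (M : Matrix V V ℝ) (hM : M.IsHermitian) : Multiset ℝ :=
  Finset.univ.val.map hM.eigenvalues

/-- Complete bipartite graph on `Fin n`, parts `{i : i < a}` and `{i : a ≤ i}`. -/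
def completeBip (n a : ℕ) : SimpleGraph (Fin n) :=
  SimpleGraph.fromRel (fun u v => ((u : ℕ) < a) ≠ ((v : ℕ) < a))

lemma spec_basis {n : ℕ} (M : Matrix (Fin n) (Fin n) ℝ) (ρ : Fin n → ℝ) (h : IsSpectrum M ρ) :
    ∃ v : Fin n → Fin n → ℝ, (∀ i u, ∑ w, M u w * v i w = ρ i * v i u) ∧
      (∀ i, ∑ u, v i u * v i u = 1) ∧
      (∀ u w, ∑ i, v i u * v i w = if u = w then 1 else 0) := by
  obtain ⟨-, hM, e, he⟩ := h
  have ho : ∀ i j, ∑ u, (hM.eigenvectorBasis (e i)) u * (hM.eigenvectorBasis (e j)) u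
      = if i = j then 1 else 0 := by
    intro i j
    have := (orthonormal_iff_ite.mp hM.eigenvectorBasis.orthonormal) (e i) (e j)
    simp only [PiLp.inner_apply, EmbeddingLike.apply_eq_iff_eq] at this
    rw [← this]
    refine Finset.sum_congr rfl fun u _ => ?_
    simp [mul_comm]
  refine ⟨fun i u => hM.eigenvectorBasis (e i) u, ?_, ?_, ?_⟩
  · intro i u
    have := congrFun (hM.mulVec_eigenvectorBasis (e i)) u
    rw [he i]
    simpa [Matrix.mulVec, dotProduct] using this
  · intro i
    simpa using ho i i
  · let A : Matrix (Fin n) (Fin n) ℝ := fun i u => hM.eigenvectorBasis (e i) u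
    have h1 : A * Aᵀ = 1 := by
      ext i j
      rw [Matrix.mul_apply, Matrix.one_apply]
      exact ho i j
    have h2 : Aᵀ * A = 1 := mul_eq_one_comm.mp h1
    intro u w
    have := congrFun (congrFun h2 u) w
    rw [Matrix.mul_apply, Matrix.one_apply] at this
    exact this

lemma spec_rep {n : ℕ} (M : Matrix (Fin n) (Fin n) ℝ) (ρ : Fin n → ℝ)
    (v : Fin n → Fin n → ℝ) (h1 : ∀ i u, ∑ w, M u w * v i w = ρ i * v i u)
    (h3 : ∀ u w, ∑ i, v i u * v i w = if u = w then (1:ℝ) else 0) (u w : Fin n) :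
    ∑ i, ρ i * (v i u * v i w) = M u w := by
  have : ∀ i, ρ i * (v i u * v i w) = ∑ x, M u x * (v i x * v i w) := by
    intro i
    rw [← mul_assoc, ← h1, Finset.sum_mul]
    exact Finset.sum_congr rfl fun _ _ => by ring
  simp_rw [this]
  rw [Finset.sum_comm]
  simp_rw [← Finset.mul_sum, h3]
  simp

lemma spec_quad {n : ℕ} (ρ : Fin n → ℝ) (v : Fin n → Fin n → ℝ) (z : Fin n → ℝ) :
    ∑ i, ρ i * (∑ u, z u * v i u) ^ 2
      = ∑ u, ∑ w, z u * z w * ∑ i, ρ i * (v i u * v i w) := by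
  have : ∀ i, ρ i * (∑ u, z u * v i u) ^ 2
      = ∑ u, ∑ w, z u * z w * (ρ i * (v i u * v i w)) := by
    intro i
    rw [sq, Finset.sum_mul_sum, Finset.mul_sum]
    refine Finset.sum_congr rfl fun u _ => ?_
    rw [Finset.mul_sum]
    exact Finset.sum_congr rfl fun w _ => by ring
  simp_rw [this]
  rw [Finset.sum_comm]
  refine Finset.sum_congr rfl fun u _ => ?_
  rw [Finset.sum_comm]
  refine Finset.sum_congr rfl fun w _ => ?_
  rw [Finset.mul_sum]

/-- sign vector of a vertex set -/
def sgn {n : ℕ} (s : Finset (Fin n)) (u : Fin n) : ℝ := if u ∈ s then 1 else -1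

lemma sgn_sq {n : ℕ} (s : Finset (Fin n)) (u : Fin n) : sgn s u * sgn s u = 1 := by
  unfold sgn; split_ifs <;> norm_num

lemma sgn_sum {n a : ℕ} (hn : n = 2 * a) (s : Finset (Fin n)) (hcard : s.card = a) :
    ∑ u, sgn s u = 0 := by
  have : ∀ u, sgn s u = 2 * (if u ∈ s then 1 else 0) - 1 := by
    intro u; unfold sgn; split_ifs <;> norm_num
  simp_rw [this, Finset.sum_sub_distrib, ← Finset.mul_sum]
  simp [hcard, hn]

/-- sum of cross distances over ordered pairs -/
noncomputable def crossSum {n : ℕ} (G : SimpleGraph (Fin n)) (s : Finset (Fin n)) : ℝ :=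
  ∑ u, ∑ w, (G.dist u w : ℝ) * ((1 - sgn s u * sgn s w) / 2)

noncomputable def sameSum {n : ℕ} (G : SimpleGraph (Fin n)) (s : Finset (Fin n)) : ℝ :=
  ∑ u, ∑ w, (G.dist u w : ℝ) * ((1 + sgn s u * sgn s w) / 2)

lemma two_wiener {n : ℕ} (G : SimpleGraph (Fin n)) :
    2 * wiener G = ∑ u, ∑ w, (G.dist u w : ℝ) := by
  unfold wiener transmission
  push_cast
  ring

lemma cross_add_same {n : ℕ} (G : SimpleGraph (Fin n)) (s : Finset (Fin n)) :
    crossSum G s + sameSum G s = 2 * wiener G := by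
  rw [two_wiener]
  unfold crossSum sameSum
  simp_rw [← Finset.sum_add_distrib]
  refine Finset.sum_congr rfl fun u _ => Finset.sum_congr rfl fun w _ => by ring

lemma cross_one {n a : ℕ} (hn : n = 2 * a) (s : Finset (Fin n)) (hcard : s.card = a) :
    ∑ u, ∑ w, ((1 - sgn s u * sgn s w) / 2) = 2 * (a:ℝ)^2 := by
  have : ∀ u : Fin n, ∑ w, ((1 - sgn s u * sgn s w) / 2) = a := by
    intro u
    rw [← Finset.sum_div, Finset.sum_sub_distrib, ← Finset.mul_sum, sgn_sum hn s hcard]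
    simp [hn]
  simp_rw [this]
  simp [hn]; ring

lemma same_two {n a : ℕ} (hn : n = 2 * a) (s : Finset (Fin n)) (hcard : s.card = a) :
    ∑ u, ∑ w, (if u = w then 0 else (1 + sgn s u * sgn s w)) = 4 * (a:ℝ) * (a - 1) := by
  have h0 : ∀ u w : Fin n, (if u = w then 0 else (1 + sgn s u * sgn s w))
      = (1 + sgn s u * sgn s w) - (if u = w then 2 else 0) := by
    intro u w
    split_ifs with h
    · subst h; rw [sgn_sq]; norm_num
    · ring
  have : ∀ u : Fin n, ∑ w, (if u = w then 0 else (1 + sgn s u * sgn s w)) = 2 * (a:ℝ) - 2 := by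
    intro u
    simp_rw [h0]
    rw [Finset.sum_sub_distrib, Finset.sum_add_distrib, ← Finset.mul_sum, sgn_sum hn s hcard]
    simp [hn]
  simp_rw [this]
  simp [hn]; ring

lemma cross_term {n : ℕ} (G : SimpleGraph (Fin n)) (hconn : G.Connected)
    (s : Finset (Fin n)) (u w : Fin n) :
    (1 - sgn s u * sgn s w) / 2 ≤ (G.dist u w : ℝ) * ((1 - sgn s u * sgn s w) / 2) := by
  by_cases h : u = w
  · subst h; rw [sgn_sq]; norm_num
  · have h1 : (1:ℝ) ≤ G.dist u w := by
      exact_mod_cast hconn.pos_dist_of_ne h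
    have h2 : 0 ≤ (1 - sgn s u * sgn s w) / 2 := by
      unfold sgn; split_ifs <;> norm_num
    nlinarith

lemma cross_ge {n a : ℕ} (hn : n = 2 * a) (G : SimpleGraph (Fin n)) (hconn : G.Connected)
    (s : Finset (Fin n)) (hcard : s.card = a) : 2 * (a:ℝ)^2 ≤ crossSum G s := by
  rw [← cross_one hn s hcard]
  exact Finset.sum_le_sum fun u _ => Finset.sum_le_sum fun w _ => cross_term G hconn s u w

lemma cross_eq {n a : ℕ} (hn : n = 2 * a) (G : SimpleGraph (Fin n)) (hconn : G.Connected)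
    (s : Finset (Fin n)) (hcard : s.card = a) (h : crossSum G s = 2 * (a:ℝ)^2)
    (u w : Fin n) (huw : u ∈ s ↔ w ∉ s) : G.Adj u w := by
  rw [← cross_one hn s hcard] at h
  have h1 := (Finset.sum_eq_sum_iff_of_le (fun u _ => Finset.sum_le_sum
    fun w _ => cross_term G hconn s u w)).mp h.symm u (Finset.mem_univ _)
  have h2 := (Finset.sum_eq_sum_iff_of_le (fun w _ => cross_term G hconn s u w)).mp h1 w
    (Finset.mem_univ _)
  have h3 : (1 - sgn s u * sgn s w) / 2 = 1 := by
    unfold sgn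
    by_cases hw : w ∈ s <;> simp_all
  rw [h3] at h2
  have : G.dist u w = 1 := by
    have : (1:ℝ) = G.dist u w := by linarith
    exact_mod_cast this.symm
  exact SimpleGraph.dist_eq_one_iff_adj.mp this

lemma same_ge {n a : ℕ} (hn : n = 2 * a) (G : SimpleGraph (Fin n)) (hconn : G.Connected)
    (s : Finset (Fin n)) (hcard : s.card = a)
    (hbip : ∀ u v, G.Adj u v → (u ∈ s ↔ v ∉ s)) : 4 * (a:ℝ) * (a - 1) ≤ sameSum G s := by
  rw [← same_two hn s hcard]
  refine Finset.sum_le_sum fun u _ => Finset.sum_le_sum fun w _ => ?_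
  split_ifs with h
  · subst h; simp
  · by_cases hs : u ∈ s ↔ w ∈ s
    · have h1 : 0 < G.dist u w := hconn.pos_dist_of_ne h
      have h2 : G.dist u w ≠ 1 := by
        intro h2
        have := hbip u w (SimpleGraph.dist_eq_one_iff_adj.mp h2)
        tauto
      have h3 : (2:ℝ) ≤ G.dist u w := by
        have : 2 ≤ G.dist u w := by omega
        exact_mod_cast this
      have h2 : 0 ≤ (1 + sgn s u * sgn s w) / 2 := by
        unfold sgn; split_ifs <;> norm_num
      nlinarith
    · have h3 : 1 + sgn s u * sgn s w = 0 := by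
        unfold sgn
        by_cases hw : w ∈ s <;> simp_all
      rw [h3]; simp

lemma distLap_apply {n : ℕ} (G : SimpleGraph (Fin n)) (u w : Fin n) :
    distLap G u w = (if u = w then (transmission G u : ℝ) else 0) - (G.dist u w : ℝ) := by
  unfold distLap
  rw [Matrix.sub_apply, Matrix.diagonal_apply]
  rfl

lemma distLap_quad {n : ℕ} (G : SimpleGraph (Fin n)) (z : Fin n → ℝ) (hz : ∀ u, z u * z u = 1) :
    ∑ u, ∑ w, z u * z w * distLap G u w
      = ∑ u, ∑ w, (G.dist u w : ℝ) * (1 - z u * z w) := by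
  refine Finset.sum_congr rfl fun u _ => ?_
  have : ∀ w, z u * z w * distLap G u w
      = (if u = w then (transmission G u : ℝ) else 0) - (G.dist u w : ℝ) * (z u * z w) := by
    intro w
    rw [distLap_apply]
    split_ifs with h
    · subst h; rw [hz]; simp
    · ring
  simp_rw [this, mul_sub, Finset.sum_sub_distrib]
  simp [transmission]

lemma distLap_trace {n : ℕ} (G : SimpleGraph (Fin n)) :
    ∑ u, distLap G u u = 2 * wiener G := by
  simp [distLap, distMatrix, wiener]
  ring

/-- package of spectral facts -/
lemma package {n a : ℕ} (hn : n = 2 * a) (hn5 : 5 ≤ n) (G : SimpleGraph (Fin n))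
    (s : Finset (Fin n)) (hcard : s.card = a)
    (ρ : Fin n → ℝ) (hρ : IsSpectrum (distLap G) ρ) :
    ∃ v : Fin n → Fin n → ℝ, ∃ p q : Fin n → ℝ,
      (∀ i, p i = ∑ u, v i u) ∧ (∀ i, q i = ∑ u, sgn s u * v i u) ∧
      (∀ i u, ∑ w, distLap G u w * v i w = ρ i * v i u) ∧
      (∀ i, ∑ u, v i u * v i u = 1) ∧
      ∑ i, ρ i = 2 * wiener G ∧
      ∑ i, p i ^ 2 = n ∧ ∑ i, q i ^ 2 = n ∧ ∑ i, ρ i * p i ^ 2 = 0 ∧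
      ∑ i, ρ i * q i ^ 2 = 2 * crossSum G s ∧
      ∀ i, p i ^ 2 + q i ^ 2 ≤ n := by
  obtain ⟨v, h1, h2, h3⟩ := spec_basis _ _ hρ
  have hr := spec_rep _ _ v h1 h3
  refine ⟨v, fun i => ∑ u, v i u, fun i => ∑ u, sgn s u * v i u, fun _ => rfl, fun _ => rfl,
    h1, h2, ?_, ?_, ?_, ?_, ?_, ?_⟩
  · rw [← distLap_trace]
    simp_rw [← hr]
    rw [Finset.sum_comm]
    simp_rw [← Finset.mul_sum, h2, mul_one]
  · have := spec_quad (fun _ => 1) v (fun _ => 1)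
    simp only [one_mul, h3] at this
    rw [this]; simp
  · have := spec_quad (fun _ => 1) v (sgn s)
    simp only [one_mul, h3] at this
    rw [this]; simp [sgn_sq]
  · have := spec_quad ρ v (fun _ => 1)
    simp only [one_mul, hr] at this
    rw [this]
    have := distLap_quad G (fun _ => 1) (by simp)
    simpa using this
  · have := spec_quad ρ v (sgn s)
    simp only [hr] at this
    rw [this, distLap_quad G _ (sgn_sq s)]
    unfold crossSum
    simp_rw [Finset.mul_sum]
    refine Finset.sum_congr rfl fun u _ => Finset.sum_congr rfl fun w _ => by ring
  · intro i
    beta_reduce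
    set p := ∑ u, v i u with hp
    set q := ∑ u, sgn s u * v i u with hq
    have hn0 : (0:ℝ) < n := by
      have : 0 < n := by omega
      exact_mod_cast this
    have h0 : 0 ≤ ∑ u, (n * v i u - (p + q * sgn s u)) ^ 2 :=
      Finset.sum_nonneg fun _ _ => sq_nonneg _
    have h4 : ∀ u, (n * v i u - (p + q * sgn s u)) ^ 2
        = (n:ℝ)^2 * (v i u * v i u) - 2 * n * p * v i u - 2 * n * q * (sgn s u * v i u)
          + (p^2 + q^2) + 2 * p * q * sgn s u := by
      intro u
      have := sgn_sq s u
      linear_combination q^2 * this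
    simp_rw [h4, Finset.sum_add_distrib, Finset.sum_sub_distrib, ← Finset.mul_sum] at h0
    rw [h2, sgn_sum hn s hcard, ← hp, ← hq] at h0
    simp at h0
    have h5 : 0 ≤ (n:ℝ) * (n - (p^2+q^2)) := by nlinarith
    have := nonneg_of_mul_nonneg_right h5 hn0
    linarith

lemma main_ge {n a : ℕ} (hn : n = 2 * a) (hn5 : 5 ≤ n) (G : SimpleGraph (Fin n))
    (s : Finset (Fin n)) (hcard : s.card = a)
    (ρ : Fin n → ℝ) (hρ : IsSpectrum (distLap G) ρ) :
    4 * (2 * wiener G / n) - 4 * crossSum G s / n ≤ DLEnergy G ρ := by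
  obtain ⟨v, p, q, -, -, -, -, hs, hp, hq, hrp, hrq, hle⟩ := package hn hn5 G s hcard ρ hρ
  have hn0 : (0:ℝ) < n := by
    have : 0 < n := by omega
    exact_mod_cast this
  unfold DLEnergy
  set t := 2 * wiener G / n with ht
  have hnt : n * t = 2 * wiener G := by rw [ht]; field_simp
  have key : ∀ i, (ρ i - t) + 2 / n * (t * p i ^ 2 + t * q i ^ 2 - ρ i * p i ^ 2 - ρ i * q i ^ 2)
      ≤ |ρ i - t| := by
    intro i
    set x := (p i ^ 2 + q i ^ 2) / n with hx
    have hx0 : 0 ≤ x := by positivity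
    have hx1 : x ≤ 1 := by rw [hx, div_le_one hn0]; exact hle i
    have : 2 / n * (t * p i ^ 2 + t * q i ^ 2 - ρ i * p i ^ 2 - ρ i * q i ^ 2)
      = 2 * (t - ρ i) * x := by rw [hx]; field_simp; ring
    rw [this]
    rcases abs_cases (ρ i - t) with ⟨h, h'⟩ | ⟨h, h'⟩ <;> rw [h] <;> nlinarith
  have := Finset.sum_le_sum fun i (_ : i ∈ Finset.univ) => key i
  simp_rw [Finset.sum_add_distrib, ← Finset.mul_sum, Finset.sum_sub_distrib,
    Finset.sum_add_distrib, ← Finset.mul_sum] at this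
  rw [hs, hp, hq, hrp, hrq] at this
  simp [hnt] at this
  refine le_trans (le_of_eq ?_) this
  field_simp; ring

lemma main_eq {n a : ℕ} (hn : n = 2 * a) (hn5 : 5 ≤ n) (G : SimpleGraph (Fin n))
    (hconn : G.Connected)
    (s : Finset (Fin n)) (hcard : s.card = a) (hG : ∀ u v, G.Adj u v ↔ (u ∈ s ↔ v ∉ s))
    (ρ : Fin n → ℝ) (hρ : IsSpectrum (distLap G) ρ) :
    DLEnergy G ρ = 12 * (a : ℝ) * ((a : ℝ) - 1) - 4 * ((n : ℝ) - 2) * wiener G / n := by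
  obtain ⟨v, p, q, hpd, hqd, hev, hv, hs, hp, hq, hrp, hrq, hle⟩ := package hn hn5 G s hcard ρ hρ
  have hn0 : (0:ℝ) < n := by
    have : 0 < n := by omega
    exact_mod_cast this
  have ha : (2:ℝ) ≤ a := by
    have : 2 ≤ a := by omega
    exact_mod_cast this
  have hnr : (n:ℝ) = 2 * a := by rw [hn]; push_cast; ring
  have hd : ∀ u w, (G.dist u w : ℝ) = (3 + sgn s u * sgn s w) / 2 - if u = w then 2 else 0 := by
    intro u w
    split_ifs with h
    · subst h; rw [sgn_sq]; simp; norm_num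
    · by_cases hs : u ∈ s ↔ w ∉ s
      · have : G.dist u w = 1 := SimpleGraph.dist_eq_one_iff_adj.mpr ((hG u w).mpr hs)
        rw [this]
        unfold sgn
        by_cases hw : w ∈ s <;> simp_all <;> norm_num
      · have h1 : 0 < G.dist u w := hconn.pos_dist_of_ne h
        have h2 : G.dist u w ≠ 1 := by
          intro h2
          exact hs ((hG u w).mp (SimpleGraph.dist_eq_one_iff_adj.mp h2))
        have h3 : G.dist u w ≤ 2 := by
          have hex : ∃ x, (u ∈ s ↔ x ∉ s) := by
            by_contra hcon
            push Not at hcon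
            by_cases hu : u ∈ s
            · have : s = Finset.univ := by
                ext x; have := hcon x; simp; tauto
              rw [this] at hcard; simp at hcard; omega
            · have : s = ∅ := by
                ext x; have := hcon x; simp; tauto
              rw [this] at hcard; simp at hcard; omega
          obtain ⟨x, hx⟩ := hex
          have e1 : G.Adj u x := (hG u x).mpr hx
          have e2 : G.Adj x w := (hG x w).mpr (by tauto)
          exact SimpleGraph.dist_le (SimpleGraph.Walk.cons e1 (SimpleGraph.Walk.cons e2 .nil))
        have : G.dist u w = 2 := by omega
        rw [this]
        unfold sgn
        by_cases hw : w ∈ s <;> simp_all <;> norm_num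
  have htr : ∀ u, (transmission G u : ℝ) = 3 * a - 2 := by
    intro u
    unfold transmission
    push_cast
    simp_rw [hd]
    rw [Finset.sum_sub_distrib, ← Finset.sum_div, Finset.sum_add_distrib, ← Finset.mul_sum,
      sgn_sum hn s hcard]
    simp [hnr]; ring
  have hW : 2 * wiener G = n * (3 * a - 2) := by
    unfold wiener
    simp_rw [htr]
    simp; ring
  have hcs : crossSum G s = 2 * (a:ℝ)^2 := by
    rw [← cross_one hn s hcard]
    unfold crossSum
    refine Finset.sum_congr rfl fun u _ => Finset.sum_congr rfl fun w _ => ?_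
    rw [hd]
    split_ifs with h
    · subst h; rw [sgn_sq]; norm_num
    · have := sgn_sq s u
      have := sgn_sq s w
      linear_combination (-(1:ℝ)/4) * sgn_sq s u * (sgn s w * sgn s w) - (1/4) * sgn_sq s w
  have hvec : ∀ i u, ρ i * v i u = 3 * a * v i u - 3 / 2 * p i - 1 / 2 * sgn s u * q i := by
    intro i u
    rw [← hev, hpd, hqd]
    have : ∀ w, distLap G u w * v i w = (if u = w then 3 * a * v i w else 0)
        - 3 / 2 * v i w - 1 / 2 * sgn s u * (sgn s w * v i w) := by
      intro w
      rw [distLap_apply, hd, htr]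
      split_ifs <;> ring
    simp_rw [this, Finset.sum_sub_distrib, ← Finset.mul_sum]
    simp
  have e1 : ∀ i, ρ i * p i = 0 := by
    intro i
    have : ∑ u, ρ i * v i u = ∑ u, (3 * a * v i u - 3 / 2 * p i - 1 / 2 * q i * sgn s u) :=
      Finset.sum_congr rfl fun u _ => by rw [hvec]; ring
    simp_rw [Finset.sum_sub_distrib, ← Finset.mul_sum] at this
    rw [sgn_sum hn s hcard, ← hpd] at this
    simp [hnr] at this
    linarith
  have e2 : ∀ i, ρ i * q i = 2 * a * q i := by
    intro i
    have : ∑ u, ρ i * (sgn s u * v i u)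
        = ∑ u, (3 * a * (sgn s u * v i u) - 3 / 2 * p i * sgn s u - 1 / 2 * q i) :=
      Finset.sum_congr rfl fun u _ => by
        linear_combination sgn s u * hvec i u - 1/2 * q i * sgn_sq s u
    simp_rw [Finset.sum_sub_distrib, ← Finset.mul_sum] at this
    rw [sgn_sum hn s hcard, ← hqd] at this
    simp [hnr] at this
    linarith
  have e3 : ∀ i, ρ i = 3 * a - 3 / 2 * p i ^ 2 - 1 / 2 * q i ^ 2 := by
    intro i
    have : ∑ u, ρ i * (v i u * v i u)
        = ∑ u, (3 * a * (v i u * v i u) - 3 / 2 * p i * v i u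
          - 1 / 2 * q i * (sgn s u * v i u)) :=
      Finset.sum_congr rfl fun u _ => by
        linear_combination v i u * hvec i u
    simp_rw [Finset.sum_sub_distrib, ← Finset.mul_sum] at this
    rw [hv, ← hqd, ← hpd] at this
    linarith
  have ht : 2 * wiener G / n = 3 * a - 2 := by rw [hW]; field_simp
  unfold DLEnergy
  rw [ht]
  have key : ∀ i, |ρ i - (3 * a - 2)| = (ρ i - (3 * a - 2))
      + 2 / n * ((3 * a - 2) * p i ^ 2 + (3 * a - 2) * q i ^ 2
        - ρ i * p i ^ 2 - ρ i * q i ^ 2) := by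
    intro i
    have e1 := e1 i
    have e2 := e2 i
    have e3 := e3 i
    by_cases hp0 : p i = 0
    · by_cases hq0 : q i = 0
      · rw [hp0, hq0] at e3 ⊢
        rw [abs_of_nonneg (by linarith)]; ring
      · have hr : ρ i = 2 * a := mul_right_cancel₀ hq0 e2
        rw [hr, hp0] at e3
        have hqq : q i ^ 2 = n := by rw [hnr]; linarith
        rw [hr, hqq, hp0, abs_of_nonpos (by linarith)]
        field_simp; ring
    · have hr : ρ i = 0 := by simpa [hp0] using e1
      have hq0 : q i = 0 := by
        rw [hr] at e2
        have : (a:ℝ) ≠ 0 := by linarith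
        simpa [this] using e2
      rw [hr, hq0] at e3
      have hpp : p i ^ 2 = n := by rw [hnr]; linarith
      rw [hr, hpp, hq0, abs_of_nonpos (by linarith)]
      field_simp; ring
  simp_rw [key, Finset.sum_add_distrib, ← Finset.mul_sum, Finset.sum_sub_distrib,
    Finset.sum_add_distrib, ← Finset.mul_sum]
  rw [hs, hp, hq, hrp, hrq, hcs, hW]
  have hW' : wiener G = n * (3 * a - 2) / 2 := by linarith
  rw [hW', hnr]
  have : (a:ℝ) ≠ 0 := by linarith
  simp [hnr]
  field_simp; ring

theorem stmt12 (a n : ℕ) (hn : n = 2 * a) (hn5 : 5 ≤ n)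
    (G : SimpleGraph (Fin n)) (hconn : G.Connected)
    (s : Finset (Fin n)) (hcard : s.card = a)
    (hbip : ∀ u v, G.Adj u v → (u ∈ s ↔ v ∉ s))
    (ρ : Fin n → ℝ) (hρ : IsSpectrum (distLap G) ρ) :
    12 * (a : ℝ) * ((a : ℝ) - 1) - 4 * ((n : ℝ) - 2) * wiener G / n ≤ DLEnergy G ρ ∧
      (DLEnergy G ρ = 12 * (a : ℝ) * ((a : ℝ) - 1) - 4 * ((n : ℝ) - 2) * wiener G / n ↔
        Nonempty (G ≃g completeBip n a)) := by
  have ha : (2:ℝ) ≤ a := by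
    have : 2 ≤ a := by omega
    exact_mod_cast this
  have ha0 : (0:ℝ) < a := by linarith
  have hnr : (n:ℝ) = 2 * a := by rw [hn]; push_cast; ring
  have hm := main_ge hn hn5 G s hcard ρ hρ
  have hc := cross_ge hn G hconn s hcard
  have hsm := same_ge hn G hconn s hcard hbip
  have hadd := cross_add_same G s
  have hid : 4 * (2 * wiener G / n) - 4 * crossSum G s / n
      = (12 * (a : ℝ) * ((a : ℝ) - 1) - 4 * ((n : ℝ) - 2) * wiener G / n)
        + 2 * (sameSum G s - 4 * a * (a - 1))
        + 2 * ((a - 1) / a * (crossSum G s - 2 * a^2)) := by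
    have : wiener G = (crossSum G s + sameSum G s) / 2 := by linarith
    rw [this, hnr]
    field_simp; ring
  have hfa : 0 < ((a:ℝ) - 1) / a := div_pos (by linarith) ha0
  have hnn : 0 ≤ ((a:ℝ) - 1) / a * (crossSum G s - 2 * a^2) :=
    mul_nonneg hfa.le (by linarith)
  have hcardt : (Finset.univ.filter fun i : Fin n => (i:ℕ) < a).card = a := by
    rw [Fin.card_filter_val_lt]; omega
  refine ⟨by linarith, ?_, ?_⟩
  · intro h
    have h0 : ((a:ℝ) - 1) / a * (crossSum G s - 2 * a^2) = 0 := by linarith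
    have hcs : crossSum G s = 2 * (a:ℝ)^2 := by
      rcases mul_eq_zero.mp h0 with h | h
      · linarith
      · linarith
    have hadj := cross_eq hn G hconn s hcard hcs
    have hce : Fintype.card {x : Fin n // x ∈ s} = Fintype.card {x : Fin n // (x:ℕ) < a} := by
      rw [Fintype.card_subtype, Fintype.card_subtype, hcardt]
      simpa using hcard
    let e := Fintype.equivOfCardEq hce
    have hf : ∀ u, (((e.extendSubtype u : Fin n) : ℕ) < a ↔ u ∈ s) := by
      intro u
      constructor
      · intro h
        by_contra hu
        exact e.extendSubtype_not_mem u hu h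
      · intro h
        exact e.extendSubtype_mem u h
    refine ⟨⟨e.extendSubtype, ?_⟩⟩
    intro u w
    simp only [completeBip, SimpleGraph.fromRel_adj, ne_eq, eq_iff_iff, hf,
      EmbeddingLike.apply_eq_iff_eq]
    constructor
    · rintro ⟨-, h⟩
      exact hadj u w (by tauto)
    · intro h
      have := hbip u w h
      exact ⟨h.ne, by tauto⟩
  · rintro ⟨f⟩
    refine main_eq hn hn5 G hconn (Finset.univ.filter fun u => ((f u : Fin n) : ℕ) < a) ?_ ?_ ρ hρ
    · refine Eq.trans ?_ hcardt
      refine Finset.card_bij (fun u _ => f u) ?_ ?_ ?_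
      · intro u hu; simpa using hu
      · intro u _ w _ h; exact f.injective h
      · intro w hw
        exact ⟨f.symm w, by simpa using hw, by simp⟩
    · intro u w
      rw [← f.map_adj_iff]
      simp only [completeBip, SimpleGraph.fromRel_adj, ne_eq, eq_iff_iff, Finset.mem_filter,
        Finset.mem_univ, true_and]
      constructor
      · rintro ⟨-, h⟩
        tauto
      · intro h
        refine ⟨?_, by tauto⟩
        intro h'
        rw [h'] at h
        tauto
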